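/- Let H be a group generated by a family X = (h_i)_{i∈I}, F the free group with basis (x_i)_{i∈I}, A the free abelian group with basis (a_i)_{i∈I}, and μ : F → V = A ≀ H the Magnus homomorphism determined by μ(x_i) = a_i h_i. If f ∈ F and μ(f) = w·g, where g ∈ H and w belongs to the base subgroup W of V, then |g|_X ≤ ‖w‖. -/

import Mathlib

/-- The word length of `g` with respect to a generating set `X`: the least length of a word in
`X ∪ X⁻¹` representing `g`. -/
noncomputable def wordLength {G : Type*} [Group G] (X : Set G) (g : G) : ℕ :=
  sInf {n | ∃ l : List G, l.length = n ∧ (∀ x ∈ l, x ∈ X ∨ x⁻¹ ∈ X) ∧ l.prod = g}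

/-- The additive automorphism of the base `H →₀ A` of a wreath product given by right
translation of the domain: `(b ∘ f)(x) = f (x * b)`. -/
noncomputable def wreathShift {H : Type*} [Group H] {A : Type*} [AddCommGroup A] (b : H) :
    (H →₀ A) ≃+ (H →₀ A) := Finsupp.domCongr (Equiv.mulRight b).symm

@[simp] theorem wreathShift_apply {H : Type*} [Group H] {A : Type*} [AddCommGroup A]
    (b : H) (f : H →₀ A) (x : H) : wreathShift b f x = f (x * b) := by
  simp [wreathShift, Finsupp.domCongr_apply]

/-- The action of `H` on the (multiplicative) base of the wreath product `A ≀ H`. -/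
noncomputable def wreathAction (H : Type*) [Group H] (A : Type*) [AddCommGroup A] :
    H →* MulAut (Multiplicative (H →₀ A)) where
  toFun b := AddEquiv.toMultiplicative (wreathShift b)
  map_one' := by
    refine MulEquiv.ext fun f => ?_
    refine Finsupp.ext fun x => ?_
    show Finsupp.equivMapDomain (Equiv.mulRight (1 : H)).symm (Multiplicative.toAdd f) x
        = (Multiplicative.toAdd f) x
    simp [Finsupp.equivMapDomain_apply]
  map_mul' := by
    intro a b
    refine MulEquiv.ext fun f => ?_
    refine Finsupp.ext fun x => ?_
    show Finsupp.equivMapDomain (Equiv.mulRight (a * b)).symm (Multiplicative.toAdd f) x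
        = Finsupp.equivMapDomain (Equiv.mulRight a).symm
            (Finsupp.equivMapDomain (Equiv.mulRight b).symm (Multiplicative.toAdd f)) x
    simp [Finsupp.equivMapDomain_apply, mul_assoc]

/-- The wreath product `A ≀ H` of an additive abelian group `A` (the lamp group, written
multiplicatively) by a group `H`, realized as a semidirect product of the base
`H →₀ A` by `H`. -/
noncomputable def WreathProd (A : Type*) [AddCommGroup A] (H : Type*) [Group H] :=
  (Multiplicative (H →₀ A)) ⋊[wreathAction H A] H

noncomputable instance (A : Type*) [AddCommGroup A] (H : Type*) [Group H] :
    Group (WreathProd A H) :=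
  inferInstanceAs (Group ((Multiplicative (H →₀ A)) ⋊[wreathAction H A] H))

/-- The embedding of the base into the wreath product. -/
noncomputable def wreathBase {A : Type*} [AddCommGroup A] {H : Type*} [Group H]
    (w : H →₀ A) : WreathProd A H :=
  SemidirectProduct.inl (Multiplicative.ofAdd w)

/-- The embedding of `H` into the wreath product. -/
noncomputable def wreathRight {A : Type*} [AddCommGroup A] {H : Type*} [Group H]
    (h : H) : WreathProd A H :=
  SemidirectProduct.inr h

/-- The norm `‖w‖` of an element of the base of `A ≀ H`, where `A` is free abelian with basis
indexed by `I`: the sum of the absolute values of all the integer coefficients. -/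
noncomputable def baseNorm {H I : Type*} (w : H →₀ (I →₀ ℤ)) : ℕ :=
  w.sum fun _ t => t.sum fun _ k => k.natAbs

theorem wl_exists {H : Type} [Group H] {X : Set H} (hgen : Subgroup.closure X = ⊤) (g : H) :
    ∃ l : List H, l.length = wordLength X g ∧ (∀ x ∈ l, x ∈ X ∨ x⁻¹ ∈ X) ∧ l.prod = g := by
  have hg : g ∈ Subgroup.closure X := by rw [hgen]; trivial
  rw [← Subgroup.mem_toSubmonoid, Subgroup.closure_toSubmonoid] at hg
  obtain ⟨l, hl, hp⟩ := Submonoid.exists_list_of_mem_closure hg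
  exact Nat.sInf_mem (s := {n | ∃ l : List H, l.length = n ∧ (∀ x ∈ l, x ∈ X ∨ x⁻¹ ∈ X) ∧
    l.prod = g}) ⟨l.length, l, rfl, hl, hp⟩

theorem wl_mul {H : Type} [Group H] {X : Set H} (hgen : Subgroup.closure X = ⊤) (g x : H)
    (hx : x ∈ X ∨ x⁻¹ ∈ X) : wordLength X (g * x) ≤ wordLength X g + 1 := by
  obtain ⟨l, hl, h1, h2⟩ := wl_exists hgen g
  refine Nat.sInf_le ⟨l ++ [x], by simp [hl], ?_, by simp [h2]⟩
  intro y hy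
  rcases List.mem_append.1 hy with hy | hy
  · exact h1 y hy
  · rw [List.mem_singleton.1 hy]; exact hx

theorem wl_one {H : Type} [Group H] (X : Set H) : wordLength X (1 : H) = 0 :=
  Nat.le_zero.1 (Nat.sInf_le ⟨[], rfl, by simp, rfl⟩)

/-- Pairing of a flow with the coboundary of a function. -/
noncomputable def flowPair {H : Type} [Group H] {I : Type} (h : I → H) (φ : H → ℤ) :
    (H →₀ (I →₀ ℤ)) →+ ℤ :=
  Finsupp.liftAddHom fun q => Finsupp.liftAddHom fun i =>
    AddMonoidHom.mulRight (φ ((h i)⁻¹ * q) - φ q)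

theorem flowPair_single {H : Type} [Group H] {I : Type} (h : I → H) (φ : H → ℤ) (q : H) (i : I)
    (k : ℤ) : flowPair h φ (Finsupp.single q (Finsupp.single i k))
      = k * (φ ((h i)⁻¹ * q) - φ q) := by
  rw [flowPair, Finsupp.liftAddHom_apply_single, Finsupp.liftAddHom_apply_single]
  rfl

theorem flowPair_shift {H : Type} [Group H] {I : Type} (h : I → H) (φ : H → ℤ) (b : H)
    (w : H →₀ (I →₀ ℤ)) :
    flowPair h φ (wreathShift b w) = flowPair h (fun q => φ (q * b⁻¹)) w := by
  simp only [flowPair, Finsupp.liftAddHom_apply, wreathShift, Finsupp.domCongr_apply]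
  rw [Finsupp.equivMapDomain_eq_mapDomain,
    Finsupp.sum_mapDomain_index_addMonoidHom]
  simp [mul_assoc]
  rfl

theorem flowPair_le {H : Type} [Group H] {I : Type} (h : I → H) (φ : H → ℤ)
    (hφ : ∀ i q, |φ ((h i)⁻¹ * q) - φ q| ≤ 1) (w : H →₀ (I →₀ ℤ)) :
    flowPair h φ w ≤ baseNorm w := by
  simp only [flowPair, baseNorm, Finsupp.liftAddHom_apply, Finsupp.sum]
  push_cast
  refine Finset.sum_le_sum fun q _ => Finset.sum_le_sum fun i _ => ?_
  show w q i * (φ ((h i)⁻¹ * q) - φ q) ≤ _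
  refine (le_abs_self _).trans ?_
  rw [abs_mul]
  exact mul_le_of_le_one_right (abs_nonneg _) (hφ i q)

/-- The invariant satisfied by the image of the Magnus homomorphism. -/
def FlowOK {H : Type} [Group H] {I : Type} (h : I → H) (v : WreathProd (I →₀ ℤ) H) : Prop :=
  ∃ (w : H →₀ (I →₀ ℤ)) (g : H), v = wreathBase w * wreathRight g ∧
    ∀ φ : H → ℤ, flowPair h φ w = φ g⁻¹ - φ 1

theorem wreath_mul {H : Type} [Group H] {A : Type} [AddCommGroup A] (w w' : H →₀ A) (g g' : H) :
    (wreathBase w * wreathRight g) * (wreathBase w' * wreathRight g') =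
      (wreathBase (w + wreathShift g w') * wreathRight (g * g') : WreathProd A H) := by
  have key : ∀ (v : H →₀ A) (k : H), (wreathBase v * wreathRight k : WreathProd A H) =
      (⟨Multiplicative.ofAdd v, k⟩ : (Multiplicative (H →₀ A)) ⋊[wreathAction H A] H) :=
    fun v k => (SemidirectProduct.mk_eq_inl_mul_inr ..).symm
  rw [key, key, key]
  rfl

theorem wreath_inj {H : Type} [Group H] {A : Type} [AddCommGroup A] (w w' : H →₀ A) (g g' : H)
    (e : (wreathBase w * wreathRight g : WreathProd A H) = wreathBase w' * wreathRight g') :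
    w = w' ∧ g = g' := by
  have e' : (⟨Multiplicative.ofAdd w, g⟩ : (Multiplicative (H →₀ A)) ⋊[wreathAction H A] H)
      = ⟨Multiplicative.ofAdd w', g'⟩ := by
    rw [SemidirectProduct.mk_eq_inl_mul_inr, SemidirectProduct.mk_eq_inl_mul_inr]; exact e
  exact ⟨congrArg SemidirectProduct.left e', congrArg SemidirectProduct.right e'⟩

theorem FlowOK.mul {H : Type} [Group H] {I : Type} {h : I → H} {u v : WreathProd (I →₀ ℤ) H}
    (hu : FlowOK h u) (hv : FlowOK h v) : FlowOK h (u * v) := by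
  obtain ⟨w, g, rfl, hw⟩ := hu
  obtain ⟨w', g', rfl, hw'⟩ := hv
  refine ⟨_, _, wreath_mul w w' g g', fun φ => ?_⟩
  rw [map_add, flowPair_shift, hw, hw']
  simp

theorem FlowOK.one {H : Type} [Group H] {I : Type} (h : I → H) :
    FlowOK h (1 : WreathProd (I →₀ ℤ) H) := by
  refine ⟨0, 1, ?_, by simp⟩
  have h1 : (wreathBase 0 : WreathProd (I →₀ ℤ) H) = 1 := map_one SemidirectProduct.inl
  have h2 : (wreathRight 1 : WreathProd (I →₀ ℤ) H) = 1 := map_one SemidirectProduct.inr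
  rw [h1, h2, one_mul]

theorem FlowOK.inv {H : Type} [Group H] {I : Type} {h : I → H} {u : WreathProd (I →₀ ℤ) H}
    (hu : FlowOK h u) : FlowOK h u⁻¹ := by
  obtain ⟨w, g, rfl, hw⟩ := hu
  refine ⟨wreathShift g⁻¹ (-w), g⁻¹, ?_, fun φ => ?_⟩
  · rw [inv_eq_iff_mul_eq_one, wreath_mul]
    have : w + wreathShift g (wreathShift g⁻¹ (-w)) = 0 := by
      refine Finsupp.ext fun x => ?_
      simp
    rw [this, mul_inv_cancel]
    have h1 : (wreathBase 0 : WreathProd (I →₀ ℤ) H) = 1 := map_one SemidirectProduct.inl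
    have h2 : (wreathRight 1 : WreathProd (I →₀ ℤ) H) = 1 := map_one SemidirectProduct.inr
    rw [h1, h2, one_mul]
  · rw [flowPair_shift, map_neg, hw]
    simp

/-- Let `μ : F → A ≀ H` be the Magnus homomorphism `μ(x_i) = a_i h_i`. If `μ(f) = w·g` with `w`
in the base and `g ∈ H`, then `|g|_X ≤ ‖w‖`, where `X = (h_i)` is the generating family. -/
theorem magnus_word_length_bound {H : Type} [Group H] {I : Type}
    (h : I → H) (hgen : Subgroup.closure (Set.range h) = ⊤)
    (f : FreeGroup I) (w : H →₀ (I →₀ ℤ)) (g : H)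
    (hf : FreeGroup.lift (fun i => wreathBase (Finsupp.single (1 : H)
            (Finsupp.single i (1 : ℤ))) * wreathRight (h i)) f
          = wreathBase w * wreathRight g) :
    wordLength (Set.range h) g ≤ baseNorm w := by
  have key : FlowOK h (FreeGroup.lift (fun i => wreathBase (Finsupp.single (1 : H)
            (Finsupp.single i (1 : ℤ))) * wreathRight (h i)) f) := by
    clear hf
    have gen : ∀ i, FlowOK h (wreathBase (Finsupp.single (1 : H)
            (Finsupp.single i (1 : ℤ))) * wreathRight (h i)) := fun i =>
      ⟨_, _, rfl, fun φ => by rw [flowPair_single]; simp⟩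
    induction f using FreeGroup.induction_on with
    | C1 => rw [map_one]; exact FlowOK.one h
    | of i => rw [FreeGroup.lift_apply_of]; exact gen i
    | inv_of i _ => rw [map_inv, FreeGroup.lift_apply_of]; exact (gen i).inv
    | mul x y hx hy => rw [map_mul]; exact hx.mul hy
  rw [hf] at key
  obtain ⟨w', g', e, hw⟩ := key
  obtain ⟨rfl, rfl⟩ := wreath_inj _ _ _ _ e
  have h1 := flowPair_le h (fun q => (wordLength (Set.range h) q⁻¹ : ℤ)) (fun i q => by
    have a := wl_mul hgen q⁻¹ (h i) (Or.inl ⟨i, rfl⟩)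
    have b := wl_mul hgen (q⁻¹ * h i) (h i)⁻¹ (Or.inr ⟨i, by simp⟩)
    simp only [mul_inv_rev, inv_inv, mul_inv_cancel_right] at *
    rw [abs_le]; omega) w
  rw [hw] at h1
  simp only [inv_inv, inv_one, wl_one] at h1
  omega
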